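/- Let f : ℝ^d → ℝ be continuous and let f_1, …, f_n : ℝ^d → ℝ be pairwise distinct affine functions such that for each i ∈ {1,…,n} there is a nonempty open set V_i ⊆ ℝ^d with f(x) = f_i(x) for all x ∈ V_i. Then every finite set 𝒫 of open connected subsets of ℝ^d with ℝ^d = ⋃_{P ∈ 𝒫} closure(P) and f affine on each P ∈ 𝒫 satisfies |𝒫| ≥ n; that is, the number of pieces of a CPA function is at least its number of distinct affine components. -/

import Mathlib

/-- An affine function `ℝ^d → ℝ`, i.e. a map of the form `x ↦ ⟨a, x⟩ + b`. -/
def IsAffineFn {d : ℕ} (g : (Fin d → ℝ) → ℝ) : Prop :=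
  ∃ (a : Fin d → ℝ) (b : ℝ), ∀ x, g x = (∑ i, a i * x i) + b

/-- `f` agrees with some affine map on the set `P`. -/
def AffineOnSet {d : ℕ} (f : (Fin d → ℝ) → ℝ) (P : Set (Fin d → ℝ)) : Prop :=
  ∃ g : (Fin d → ℝ) → ℝ, IsAffineFn g ∧ ∀ x ∈ P, f x = g x

/-- `Ps` is an admissible (finite) set of pieces for `f`: all pieces are open,
connected, `f` is affine on each of them, and their closures cover `ℝ^d`. -/
def IsPieceSet {d : ℕ} (f : (Fin d → ℝ) → ℝ) (Ps : Finset (Set (Fin d → ℝ))) : Prop :=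
  (∀ P ∈ Ps, IsOpen P ∧ IsConnected P ∧ AffineOnSet f P) ∧
    (⋃ P ∈ Ps, closure P) = Set.univ

/-- A continuous piecewise affine (CPA) function. -/
def IsCPA {d : ℕ} (f : (Fin d → ℝ) → ℝ) : Prop :=
  Continuous f ∧ ∃ Ps : Finset (Set (Fin d → ℝ)), IsPieceSet f Ps

/-- `P` is a maximal piece of `f`: open, connected, `f` affine on `P`, and it cannot
be enlarged by a nonempty set `U ⊆ ℝ^d \ P` keeping openness, connectedness and affineness. -/
def IsMaximalPiece {d : ℕ} (f : (Fin d → ℝ) → ℝ) (P : Set (Fin d → ℝ)) : Prop :=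
  IsOpen P ∧ IsConnected P ∧ AffineOnSet f P ∧
    ¬ ∃ U : Set (Fin d → ℝ), U.Nonempty ∧ U ⊆ Pᶜ ∧ IsOpen (P ∪ U) ∧
      IsConnected (P ∪ U) ∧ AffineOnSet f (P ∪ U)

theorem IsAffineFn.apply_lineMap {d : ℕ} {g : (Fin d → ℝ) → ℝ} (hg : IsAffineFn g)
    (x y : Fin d → ℝ) (t : ℝ) : g (x + t • (y - x)) = (1 - t) * g x + t * g y := by
  obtain ⟨a, b, h⟩ := hg
  have hsum : ∑ i, a i * (x + t • (y - x)) i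
      = (1 - t) * ∑ i, a i * x i + t * ∑ i, a i * y i := by
    rw [Finset.mul_sum, Finset.mul_sum, ← Finset.sum_add_distrib]
    refine Finset.sum_congr rfl fun i _ => ?_
    simp only [Pi.add_apply, Pi.smul_apply, Pi.sub_apply, smul_eq_mul]
    ring
  rw [h, h, h, hsum]
  ring

/-- Two affine functions that agree on a nonempty open set are equal. -/
theorem IsAffineFn.eq_of_eqOn_isOpen {d : ℕ} {g h : (Fin d → ℝ) → ℝ} (hg : IsAffineFn g)
    (hh : IsAffineFn h) {U : Set (Fin d → ℝ)} (hU : IsOpen U) (hne : U.Nonempty)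
    (heq : Set.EqOn g h U) : g = h := by
  obtain ⟨x, hx⟩ := hne
  funext y
  have hcont : Continuous fun t : ℝ => x + t • (y - x) := by fun_prop
  have hmem : ∀ᶠ t in nhds (0 : ℝ), x + t • (y - x) ∈ U :=
    hcont.continuousAt.eventually_mem (hU.mem_nhds (by simpa using hx))
  obtain ⟨t, htU, ht⟩ :=
    ((hmem.filter_mono nhdsWithin_le_nhds).and
      (self_mem_nhdsWithin : {(0 : ℝ)}ᶜ ∈ nhdsWithin 0 {0}ᶜ)).exists
  have key := heq htU
  rw [hg.apply_lineMap, hh.apply_lineMap, heq hx] at key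
  exact mul_left_cancel₀ ht (add_left_cancel key)

/-- If continuous `f` agrees with each of `n` pairwise distinct affine
functions on some nonempty open set, then every admissible set of pieces for `f` has at
least `n` elements: the number of pieces is at least the number of distinct affine
components. -/
theorem pieces_ge_components {d n : ℕ} (f : (Fin d → ℝ) → ℝ) (hf : Continuous f)
    (F : Fin n → (Fin d → ℝ) → ℝ) (hF : ∀ i, IsAffineFn (F i))
    (hdist : Function.Injective F)
    (hV : ∀ i, ∃ V : Set (Fin d → ℝ), V.Nonempty ∧ IsOpen V ∧ ∀ x ∈ V, f x = F i x) :
    ∀ Ps : Finset (Set (Fin d → ℝ)), IsPieceSet f Ps → n ≤ Ps.card := by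
  intro Ps ⟨hPs, hcover⟩
  have hpiece : ∀ i, ∃ P ∈ Ps, ∃ U ⊆ P, IsOpen U ∧ U.Nonempty ∧ Set.EqOn f (F i) U := by
    intro i
    obtain ⟨V, ⟨x, hx⟩, hVo, hfV⟩ := hV i
    have hxc : x ∈ ⋃ P ∈ Ps, closure P := hcover ▸ Set.mem_univ x
    simp only [Set.mem_iUnion] at hxc
    obtain ⟨P, hP, hxP⟩ := hxc
    exact ⟨P, hP, V ∩ P, Set.inter_subset_right, hVo.inter (hPs P hP).1,
      mem_closure_iff.1 hxP V hVo hx, fun y hy => hfV y hy.1⟩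
  choose p hp U hUp hUo hUne hfU using hpiece
  have hinj : Function.Injective p := by
    intro i j hij
    obtain ⟨g, hg, hfg⟩ := (hPs _ (hp i)).2.2
    have hi : g = F i := hg.eq_of_eqOn_isOpen (hF i) (hUo i) (hUne i) fun x hx =>
      (hfg x (hUp i hx)).symm.trans (hfU i hx)
    have hj : g = F j := hg.eq_of_eqOn_isOpen (hF j) (hUo j) (hUne j) fun x hx =>
      (hfg x (hij ▸ hUp j hx)).symm.trans (hfU j hx)
    exact hdist (hi.symm.trans hj)
  simpa using Finset.card_le_card_of_injOn (s := Finset.univ) p (fun i _ => hp i) hinj.injOn
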